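/- arXiv:1906.09927 — 5 statements merged into one kernel-verified Lean document; each statement's English description precedes it below -/
import Mathlib

section
/- Let p > 2 and let g : ℝ → ℝ be a continuous function such that g(s)/(|s|^{p-2} s) → 1 as |s| → +∞. Then there exist θ > 2 and M > 0 such that s g(s) − θ G(s) > 0 for all s with |s| ≥ M, where G(s) = ∫₀^s g(t) dt. -/
open Filter MeasureTheory Topology intervalIntegral

/-- A continuous function asymptotic to `s ^ (p - 1)` at `+∞` satisfies the
Ambrosetti–Rabinowitz inequality near `+∞` for every exponent `θ ∈ (0, p)`. -/
theorem eventually_pos_mul_sub_mul_integral {p θ : ℝ} (hθ : 0 < θ) (hθp : θ < p) {g : ℝ → ℝ}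
    (hg : Continuous g) (hlim : Tendsto (fun s : ℝ => g s / s ^ (p - 1)) atTop (𝓝 1)) :
    ∀ᶠ s in atTop, 0 < s * g s - θ * ∫ t in (0 : ℝ)..s, g t := by
  have hp : 0 < p := hθ.trans hθp
  obtain ⟨ε, hε, hεθ⟩ : ∃ ε : ℝ, 0 < ε ∧ θ * (1 + ε) < p * (1 - ε) := by
    refine ⟨(p - θ) / (2 * (p + θ)), div_pos (by linarith) (by linarith), ?_⟩
    have h : (p - θ) / (2 * (p + θ)) * (p + θ) = (p - θ) / 2 := by field_simp
    nlinarith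
  have hbound : ∀ᶠ s in atTop,
      (1 - ε) * s ^ (p - 1) ≤ g s ∧ g s ≤ (1 + ε) * s ^ (p - 1) := by
    filter_upwards [hlim.eventually (Icc_mem_nhds (show 1 - ε < 1 by linarith)
      (show 1 < 1 + ε by linarith)), eventually_gt_atTop 0] with s hs hs0
    have hpow : 0 < s ^ (p - 1) := Real.rpow_pos_of_pos hs0 _
    exact ⟨(le_div_iff₀ hpow).1 hs.1, (div_le_iff₀ hpow).1 hs.2⟩
  obtain ⟨N, hN⟩ := eventually_atTop.1 hbound
  set m := max N 1
  set C := ∫ t in (0 : ℝ)..m, g t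
  have hm : 0 < m := zero_lt_one.trans_le (le_max_right _ _)
  have hδ : 0 < p * (1 - ε) - θ * (1 + ε) := by linarith
  filter_upwards [eventually_ge_atTop m,
    ((tendsto_rpow_atTop hp).const_mul_atTop hδ).eventually_gt_atTop (p * θ * C)]
    with s hs hlarge
  have hs0 : 0 < s := hm.trans_le hs
  have hsplit : ∫ t in (0 : ℝ)..s, g t = C + ∫ t in m..s, g t :=
    (integral_add_adjacent_intervals (hg.intervalIntegrable _ _)
      (hg.intervalIntegrable _ _)).symm
  have hupper : ∫ t in m..s, g t ≤ ∫ t in m..s, (1 + ε) * t ^ (p - 1) :=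
    integral_mono_on hs (hg.intervalIntegrable _ _)
      ((intervalIntegrable_rpow' (by linarith)).const_mul _)
      fun t ht => (hN t ((le_max_left _ _).trans ht.1)).2
  rw [intervalIntegral.integral_const_mul, integral_rpow (Or.inl (by linarith)),
    sub_add_cancel] at hupper
  have hupper' : p * ∫ t in m..s, g t ≤ (1 + ε) * s ^ p := by
    calc p * ∫ t in m..s, g t ≤ p * ((1 + ε) * ((s ^ p - m ^ p) / p)) := by gcongr
      _ = (1 + ε) * (s ^ p - m ^ p) := by field_simp
      _ ≤ (1 + ε) * s ^ p := by
        gcongr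
        linarith [Real.rpow_pos_of_pos hm p]
  have hlower : (1 - ε) * s ^ p ≤ s * g s := by
    calc (1 - ε) * s ^ p = s * ((1 - ε) * s ^ (p - 1)) := by
          rw [Real.rpow_sub_one hs0.ne']
          field_simp
      _ ≤ s * g s := by
        gcongr
        exact (hN s ((le_max_left _ _).trans hs)).1
  refine pos_of_mul_pos_right (a := p) ?_ hp.le
  rw [hsplit]
  linarith [mul_le_mul_of_nonneg_left hupper' hθ.le, mul_le_mul_of_nonneg_left hlower hp.le]

/-- If `p > 2` and `g : ℝ → ℝ` is continuous with
`g s / (|s|^(p-2) s) → 1` as `|s| → +∞`, then there are `θ > 2` and `M > 0`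
such that `s g(s) - θ G(s) > 0` for all `|s| ≥ M`, where `G s = ∫₀^s g`. -/
theorem stmt_1 (p : ℝ) (hp : 2 < p) (g : ℝ → ℝ) (hg : Continuous g)
    (hlim : Filter.Tendsto (fun s : ℝ => g s / (|s| ^ (p - 2) * s))
      (Filter.cocompact ℝ) (nhds 1)) :
    ∃ θ : ℝ, 2 < θ ∧ ∃ M : ℝ, 0 < M ∧ ∀ s : ℝ, M ≤ |s| →
      0 < s * g s - θ * ∫ t in (0:ℝ)..s, g t := by
  rw [cocompact_eq_atBot_atTop, tendsto_sup] at hlim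
  have hpow : ∀ s : ℝ, 0 < s → |s| ^ (p - 2) * s = s ^ (p - 1) := fun s hs => by
    rw [abs_of_pos hs, ← Real.rpow_add_one hs.ne']
    ring_nf
  have hright := eventually_pos_mul_sub_mul_integral (p := p) (θ := (p + 2) / 2)
    (by linarith) (by linarith) hg <| hlim.2.congr' <| by
      filter_upwards [eventually_gt_atTop 0] with s hs
      rw [hpow s hs]
  have hleft := eventually_pos_mul_sub_mul_integral (p := p) (θ := (p + 2) / 2)
    (g := fun s => -g (-s)) (by linarith) (by linarith) (by fun_prop) <|
    (hlim.1.comp tendsto_neg_atTop_atBot).congr' <| by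
      filter_upwards [eventually_gt_atTop 0] with s hs
      rw [Function.comp_apply, abs_neg, mul_neg, hpow s hs, div_neg, neg_div]
  obtain ⟨N, hN⟩ := eventually_atTop.1 (hright.and hleft)
  refine ⟨(p + 2) / 2, by linarith, max N 1, by positivity, fun s hs => ?_⟩
  have hNs := hN |s| ((le_max_left _ _).trans hs)
  rcases le_total 0 s with h | h
  · simpa only [abs_of_nonneg h] using hNs.1
  · have hneg := hNs.2
    rw [abs_of_nonpos h, intervalIntegral.integral_neg, integral_comp_neg, neg_neg, neg_zero,
      ← integral_symm, neg_mul_neg] at hneg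
    exact hneg
end

section
/- Let f : ℝ → ℝ be a continuous function satisfying the Ambrosetti–Rabinowitz condition: there exist θ > 2 and M > 0 such that 0 < θ F(s) ≤ s f(s) for all |s| ≥ M, where F(s) = ∫₀^s f(t) dt. Then there exists σ > 0 such that 𝓕(s) = s f(s) − 2F(s) ≥ σ s² for all s with |s| ≥ M. -/
open Filter MeasureTheory Topology intervalIntegral

/-- If `2 G s ≤ s G' s` for `s ≥ M > 0`, then `G s / s ^ 2` is at least its value at `M`. -/
lemma mul_sq_le_of_two_mul_le_mul_deriv {G g : ℝ → ℝ} {M s : ℝ} (hM : 0 < M)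
    (hG : ∀ x, M ≤ x → HasDerivAt G (g x) x) (h : ∀ x, M ≤ x → 2 * G x ≤ x * g x)
    (hs : M ≤ s) : G M / M ^ 2 * s ^ 2 ≤ G s := by
  have hderiv : ∀ x, M ≤ x →
      HasDerivAt (fun x => G x / x ^ 2) ((g x * x ^ 2 - G x * (2 * x)) / (x ^ 2) ^ 2) x := by
    intro x hx
    have hx0 : x ^ 2 ≠ 0 := pow_ne_zero 2 (hM.trans_le hx).ne'
    have hsq : HasDerivAt (fun x : ℝ => x ^ 2) (2 * x) x := by
      simpa using hasDerivAt_pow 2 x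
    exact (hG x hx).div hsq hx0
  have hmono : MonotoneOn (fun x => G x / x ^ 2) (Set.Ici M) := by
    refine monotoneOn_of_deriv_nonneg (convex_Ici M)
      (fun x hx => (hderiv x hx).continuousAt.continuousWithinAt)
      (fun x hx => (hderiv x (interior_subset hx)).differentiableAt.differentiableWithinAt) ?_
    intro x hx
    have hx' : M ≤ x := interior_subset hx
    rw [(hderiv x hx').deriv]
    refine div_nonneg ?_ (by positivity)
    nlinarith [mul_nonneg (hM.le.trans hx') (sub_nonneg.2 (h x hx'))]
  have hs0 : 0 < s := hM.trans_le hs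
  exact (le_div_iff₀ (by positivity)).1 (hmono Set.self_mem_Ici hs hs)

/-- If `f : ℝ → ℝ` is continuous and satisfies the
Ambrosetti–Rabinowitz condition (`θ > 2`, `M > 0`, `0 < θ F(s) ≤ s f(s)` for
`|s| ≥ M`, where `F s = ∫₀^s f`), then there is `σ > 0` such that
`𝓕 s = s f s - 2 F s ≥ σ s²` for all `|s| ≥ M`. -/
theorem stmt_6 (f : ℝ → ℝ) (hf : Continuous f) (θ M : ℝ) (hθ : 2 < θ) (hM : 0 < M)
    (hAR : ∀ s : ℝ, M ≤ |s| →
      0 < θ * (∫ t in (0:ℝ)..s, f t) ∧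
        θ * (∫ t in (0:ℝ)..s, f t) ≤ s * f s) :
    ∃ σ : ℝ, 0 < σ ∧ ∀ s : ℝ, M ≤ |s| →
      σ * s ^ 2 ≤ s * f s - 2 * ∫ t in (0:ℝ)..s, f t := by
  set F : ℝ → ℝ := fun s => ∫ t in (0:ℝ)..s, f t
  change ∀ s : ℝ, M ≤ |s| → 0 < θ * F s ∧ θ * F s ≤ s * f s at hAR
  change ∃ σ : ℝ, 0 < σ ∧ ∀ s : ℝ, M ≤ |s| → σ * s ^ 2 ≤ s * f s - 2 * F s
  have hderiv : ∀ x, HasDerivAt F (f x) x := fun x => hf.integral_hasStrictDerivAt 0 x |>.hasDerivAt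
  have hpos : ∀ s, M ≤ |s| → 0 < F s := fun s hs =>
    (mul_pos_iff_of_pos_left (by linarith)).1 (hAR s hs).1
  have htwo : ∀ s, M ≤ |s| → 2 * F s ≤ s * f s := fun s hs => by
    nlinarith [hpos s hs, (hAR s hs).2]
  have hright : ∀ s, M ≤ s → F M / M ^ 2 * s ^ 2 ≤ F s := fun s hs =>
    mul_sq_le_of_two_mul_le_mul_deriv hM (fun x _ => hderiv x)
      (fun x hx => htwo x (hx.trans (le_abs_self x))) hs
  have hleft : ∀ s, M ≤ s → F (-M) / M ^ 2 * s ^ 2 ≤ F (-s) := fun s hs =>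
    mul_sq_le_of_two_mul_le_mul_deriv (G := fun x => F (-x)) (g := fun x => -f (-x)) hM
      (fun x _ => by simpa [Function.comp_def] using (hderiv (-x)).comp x (hasDerivAt_neg x))
      (fun x hx => by
        have := htwo (-x) (by rw [abs_neg]; exact hx.trans (le_abs_self x))
        linarith) hs
  have hFM : 0 < F M := hpos M (le_abs_self M)
  have hFM' : 0 < F (-M) := hpos (-M) (by rw [abs_neg]; exact le_abs_self M)
  set c := min (F M / M ^ 2) (F (-M) / M ^ 2)
  have hc0 : 0 < c := lt_min (by positivity) (by positivity)
  have hbound : ∀ s, M ≤ |s| → c * s ^ 2 ≤ F s := by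
    intro s hs
    rcases le_abs.1 hs with h | h
    · exact (mul_le_mul_of_nonneg_right (min_le_left _ _) (sq_nonneg s)).trans (hright s h)
    · have := hleft (-s) h
      rw [neg_neg, neg_sq] at this
      exact (mul_le_mul_of_nonneg_right (min_le_right _ _) (sq_nonneg s)).trans this
  refine ⟨(θ - 2) * c, mul_pos (by linarith) hc0, fun s hs => ?_⟩
  nlinarith [mul_le_mul_of_nonneg_left (hbound s hs) (sub_pos.2 hθ).le, (hAR s hs).2]
end

section
/- Let q > 2 and let f : ℝ → ℝ be continuous with: (f₇) there exist C > 0 and p with 2 < p < q such that |f(s)| ≤ C(1 + |s|^{p−1}) for all s ∈ ℝ; and (f₈) for each s₀ > 0 there is σ > 0 with s f(s) − 2F(s) ≥ σ s² for all |s| ≥ s₀, where F(s) = ∫₀^s f(t) dt. For ε > 0 define g_ε(s) = f(s) + ε|s|^{q−2}s and G_ε(s) = F(s) + (ε/q)|s|^q. Then there exist θ > 2 and M > 0 such that s g_ε(s) − θ G_ε(s) > 0 for all s with |s| ≥ M. -/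
open Filter MeasureTheory Topology intervalIntegral

/-- A growth bound of order `p - 1` on `f` gives a bound of order `p` on its primitive. -/
theorem abs_primitive_le_of_growth {f : ℝ → ℝ} {C p : ℝ} (hC : 0 ≤ C) (hp : 1 ≤ p)
    (hf : ∀ s : ℝ, |f s| ≤ C * (1 + |s| ^ (p - 1))) {s : ℝ} (hs : 1 ≤ |s|) :
    |∫ t in (0:ℝ)..s, f t| ≤ 2 * C * |s| ^ p := by
  have hs0 : 0 < |s| := by linarith
  have hbound : ∀ t ∈ Set.uIoc 0 s, ‖f t‖ ≤ C * (1 + |s| ^ (p - 1)) := by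
    intro t ht
    have hts : |t| ≤ |s| := by
      simpa using Set.abs_sub_left_of_mem_uIcc (Set.uIoc_subset_uIcc ht)
    refine (hf t).trans ?_
    gcongr
  have hint := norm_integral_le_of_norm_le_const hbound
  rw [Real.norm_eq_abs, sub_zero] at hint
  have hmul : |s| ^ (p - 1) * |s| = |s| ^ p := by
    rw [← Real.rpow_add_one hs0.ne', sub_add_cancel]
  have hle : |s| ≤ |s| ^ p := Real.self_le_rpow_of_one_le hs hp
  calc |∫ t in (0:ℝ)..s, f t| ≤ C * (1 + |s| ^ (p - 1)) * |s| := hint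
    _ = C * (|s| + |s| ^ p) := by rw [← hmul]; ring
    _ ≤ C * (|s| ^ p + |s| ^ p) := by gcongr
    _ = 2 * C * |s| ^ p := by ring

/-- Let `q > 2` and `f : ℝ → ℝ` continuous with
(f₇) there are `C > 0` and `2 < p < q` with `|f s| ≤ C (1 + |s|^(p-1))` for all `s`;
(f₈) for each `s₀ > 0` there is `σ > 0` with `s f s - 2 F s ≥ σ s²` for `|s| ≥ s₀`,
where `F s = ∫₀^s f`. For `ε > 0` set `g_ε s = f s + ε |s|^(q-2) s` and
`G_ε s = F s + (ε/q) |s|^q`. Then there are `θ > 2` and `M > 0` with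
`s g_ε s - θ G_ε s > 0` for all `|s| ≥ M`. -/
theorem stmt_11 (q : ℝ) (hq : 2 < q) (f : ℝ → ℝ) (hf : Continuous f)
    (C p : ℝ) (hC : 0 < C) (hp : 2 < p) (hpq : p < q)
    (hf7 : ∀ s : ℝ, |f s| ≤ C * (1 + |s| ^ (p - 1)))
    (hf8 : ∀ s₀ : ℝ, 0 < s₀ → ∃ σ : ℝ, 0 < σ ∧ ∀ s : ℝ, s₀ ≤ |s| →
      σ * s ^ 2 ≤ s * f s - 2 * ∫ t in (0:ℝ)..s, f t)
    (ε : ℝ) (hε : 0 < ε) :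
    ∃ θ : ℝ, 2 < θ ∧ ∃ M : ℝ, 0 < M ∧ ∀ s : ℝ, M ≤ |s| →
      0 < s * (f s + ε * |s| ^ (q - 2) * s) -
        θ * ((∫ t in (0:ℝ)..s, f t) + (ε / q) * |s| ^ q) := by
  obtain ⟨σ, hσ, h8⟩ := hf8 1 one_pos
  obtain ⟨N, hN⟩ := eventually_atTop.1
    ((tendsto_rpow_atTop (sub_pos.2 hpq)).eventually_ge_atTop (2 * C * q / ε))
  refine ⟨(q + 2) / 2, by linarith, max 1 N, by positivity, fun s hs => ?_⟩
  have hs1 : 1 ≤ |s| := (le_max_left _ _).trans hs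
  have hs0 : 0 < |s| := by linarith
  have hsq : 0 < σ * s ^ 2 := mul_pos hσ (sq_pos_of_pos hs0 |>.trans_eq (sq_abs s))
  have hF := (le_abs_self _).trans
    (abs_primitive_le_of_growth hC.le (by linarith) hf7 hs1)
  have hlarge : 2 * C * |s| ^ p ≤ ε / q * |s| ^ q := by
    have hK := hN |s| ((le_max_right _ _).trans hs)
    have hsplit : |s| ^ q = |s| ^ (q - p) * |s| ^ p := by
      rw [← Real.rpow_add hs0, sub_add_cancel]
    calc 2 * C * |s| ^ p = ε / q * (2 * C * q / ε * |s| ^ p) := by field_simp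
      _ ≤ ε / q * |s| ^ q := by rw [hsplit]; gcongr
  have hpow : s * (ε * |s| ^ (q - 2) * s) = q * (ε / q * |s| ^ q) := by
    have hsplit : |s| ^ q = |s| ^ (q - 2) * s ^ 2 := by
      rw [← sq_abs, ← Real.rpow_natCast, ← Real.rpow_add hs0]
      norm_num
    rw [hsplit]
    field_simp
  have h8s := h8 s hs1
  rw [mul_add, hpow]
  nlinarith [mul_nonneg (sub_pos.2 hq).le (sub_nonneg.2 (hF.trans hlarge))]
end

section
/- Let f, h : ℝ → ℝ be continuous, Υ > 0, and β ≥ 0, with f(s) > 0 for all s > 0, h(s) ≥ 0 for all s ≥ 0, and h(s) f(Υ) ≤ h(Υ) f(s) for all s ∈ (0, Υ]. Define h_Υ(s) = h(s) for s ∈ [0, Υ] and h_Υ(s) = (h(Υ)/f(Υ)) f(s) for s ≥ Υ, and set f_Υ(s) = f(s) + β h_Υ(s) for s ≥ 0, F_Υ(s) = ∫₀^s f_Υ(t) dt, and F(s) = ∫₀^s f(t) dt. Then for all s ≥ Υ, s f_Υ(s) − 2 F_Υ(s) ≥ (1 + β h(Υ)/f(Υ)) (s f(s) − 2 F(s)).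 -/
open Filter MeasureTheory Topology intervalIntegral

/-- Let `f, h : ℝ → ℝ` be continuous, `Υ > 0`, `β ≥ 0`, with `f > 0`
on `(0,∞)`, `h ≥ 0` on `[0,∞)`, and `h s * f Υ ≤ h Υ * f s` for `s ∈ (0, Υ]`. Let
`hΥ` agree with `h` on `[0, Υ]` and with `(h Υ / f Υ) f` on `[Υ, ∞)`, and set
`fΥ s = f s + β hΥ s` (for `s ≥ 0`), `FΥ s = ∫₀^s fΥ`, `F s = ∫₀^s f`. Then for
all `s ≥ Υ`: `s fΥ s - 2 FΥ s ≥ (1 + β h Υ / f Υ) (s f s - 2 F s)`. -/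
theorem stmt_14 (f h : ℝ → ℝ) (hf : Continuous f) (hh : Continuous h)
    (Υ β : ℝ) (hΥpos : 0 < Υ) (hβ : 0 ≤ β)
    (hfpos : ∀ s : ℝ, 0 < s → 0 < f s)
    (hhnonneg : ∀ s : ℝ, 0 ≤ s → 0 ≤ h s)
    (hratio : ∀ s : ℝ, 0 < s → s ≤ Υ → h s * f Υ ≤ h Υ * f s)
    (hT : ℝ → ℝ)
    (hT1 : ∀ s : ℝ, 0 ≤ s → s ≤ Υ → hT s = h s)
    (hT2 : ∀ s : ℝ, Υ ≤ s → hT s = (h Υ / f Υ) * f s) :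
    ∀ s : ℝ, Υ ≤ s →
      (1 + β * h Υ / f Υ) * (s * f s - 2 * ∫ t in (0:ℝ)..s, f t) ≤
        s * (f s + β * hT s) - 2 * ∫ t in (0:ℝ)..s, (f t + β * hT t) := by
  intro s hs
  have h_fΥ : 0 < f Υ := hfpos Υ hΥpos
  have h_int_left : IntervalIntegrable hT volume 0 Υ :=
    (hh.intervalIntegrable 0 Υ).congr fun t ht => by
      rw [Set.uIoc_of_le hΥpos.le] at ht
      exact (hT1 t ht.1.le ht.2).symm
  have h_int_right : IntervalIntegrable hT volume Υ s :=
    ((hf.intervalIntegrable Υ s).const_mul (h Υ / f Υ)).congr fun t ht => by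
      rw [Set.uIoc_of_le hs] at ht
      exact (hT2 t ht.1.le).symm
  have h_int : IntervalIntegrable hT volume 0 s := h_int_left.trans h_int_right
  have h_le : ∀ t ∈ Set.Ioo 0 s, hT t ≤ h Υ / f Υ * f t := by
    intro t ht
    rcases le_total t Υ with htΥ | htΥ
    · rw [hT1 t ht.1.le htΥ, div_mul_eq_mul_div, le_div_iff₀ h_fΥ]
      exact hratio t ht.1 htΥ
    · exact (hT2 t htΥ).le
  have h_mono : ∫ t in (0:ℝ)..s, hT t ≤ h Υ / f Υ * ∫ t in (0:ℝ)..s, f t := by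
    rw [← intervalIntegral.integral_const_mul]
    exact integral_mono_on_of_le_Ioo (hΥpos.le.trans hs) h_int
      ((hf.intervalIntegrable 0 s).const_mul _) h_le
  rw [integral_add (hf.intervalIntegrable 0 s) (h_int.const_mul β), intervalIntegral.integral_const_mul,
    hT2 s hs, mul_div_assoc]
  linarith [mul_le_mul_of_nonneg_left h_mono hβ]
end

section
/- Let f, h : ℝ → ℝ be continuous, Υ > 0, with f(s) > 0 for all s > 0, h(s) ≥ 0 for all s ≥ 0, h(Υ) > 0, h(s) f(Υ) ≤ h(Υ) f(s) for all s ∈ (0, Υ], and satisfying: (f₈) for each s₀ > 0 there is σ > 0 with s f(s) − 2F(s) ≥ σ s² for all |s| ≥ s₀; and (h₃) for each s₀ > 0 there is σ₀ > 0 with s h(s) − 2H(s) ≥ σ₀ s² for all |s| ≥ s₀, where F(s) = ∫₀^s f(t) dt and H(s) = ∫₀^s h(t) dt. Let β ∈ [0, f(Υ)/h(Υ)], define h_Υ(s) = h(s) for s ∈ [0, Υ] and h_Υ(s) = (h(Υ)/f(Υ)) f(s) for s ≥ Υ, set f_Υ(s) = f(s) + β h_Υ(s) for s ≥ 0 and F_Υ(s)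 = ∫₀^s f_Υ(t) dt. Then for each s₀ > 0 there exists σ > 0 such that s f_Υ(s) − 2 F_Υ(s) ≥ σ s² for all s ≥ s₀. -/
open Filter MeasureTheory Topology intervalIntegral

/-- Let `f, h : ℝ → ℝ` be continuous, `Υ > 0`, with `f > 0` on `(0,∞)`,
`h ≥ 0` on `[0,∞)`, `h Υ > 0`, `h s * f Υ ≤ h Υ * f s` on `(0, Υ]`, and satisfying
(f₈): for each `s₀ > 0` there is `σ > 0` with `s f s - 2 F s ≥ σ s²` for `|s| ≥ s₀`;
(h₃): for each `s₀ > 0` there is `σ₀ > 0` with `s h s - 2 H s ≥ σ₀ s²` for `|s| ≥ s₀`,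
where `F s = ∫₀^s f`, `H s = ∫₀^s h`. Let `β ∈ [0, f Υ / h Υ]`, let `hΥ` agree with
`h` on `[0, Υ]` and with `(h Υ / f Υ) f` on `[Υ, ∞)`, and set `fΥ s = f s + β hΥ s`
(for `s ≥ 0`), `FΥ s = ∫₀^s fΥ`. Then for each `s₀ > 0` there is `σ > 0` with
`s fΥ s - 2 FΥ s ≥ σ s²` for all `s ≥ s₀`. -/
theorem stmt_15 (f h : ℝ → ℝ) (hf : Continuous f) (hh : Continuous h)
    (Υ : ℝ) (hΥpos : 0 < Υ)
    (hfpos : ∀ s : ℝ, 0 < s → 0 < f s)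
    (hhnonneg : ∀ s : ℝ, 0 ≤ s → 0 ≤ h s)
    (hhΥpos : 0 < h Υ)
    (hratio : ∀ s : ℝ, 0 < s → s ≤ Υ → h s * f Υ ≤ h Υ * f s)
    (hf8 : ∀ s₀ : ℝ, 0 < s₀ → ∃ σ : ℝ, 0 < σ ∧ ∀ s : ℝ, s₀ ≤ |s| →
      σ * s ^ 2 ≤ s * f s - 2 * ∫ t in (0:ℝ)..s, f t)
    (hh3 : ∀ s₀ : ℝ, 0 < s₀ → ∃ σ₀ : ℝ, 0 < σ₀ ∧ ∀ s : ℝ, s₀ ≤ |s| →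
      σ₀ * s ^ 2 ≤ s * h s - 2 * ∫ t in (0:ℝ)..s, h t)
    (β : ℝ) (hβ0 : 0 ≤ β) (hβ1 : β ≤ f Υ / h Υ)
    (hT : ℝ → ℝ)
    (hT1 : ∀ s : ℝ, 0 ≤ s → s ≤ Υ → hT s = h s)
    (hT2 : ∀ s : ℝ, Υ ≤ s → hT s = (h Υ / f Υ) * f s) :
    ∀ s₀ : ℝ, 0 < s₀ → ∃ σ : ℝ, 0 < σ ∧ ∀ s : ℝ, s₀ ≤ s →
      σ * s ^ 2 ≤ s * (f s + β * hT s) - 2 * ∫ t in (0:ℝ)..s, (f t + β * hT t) := by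
  have hfΥ : 0 < f Υ := hfpos Υ hΥpos
  set c := h Υ / f Υ with hc
  have hc0 : 0 < c := div_pos hhΥpos hfΥ
  have hle : ∀ t : ℝ, 0 < t → hT t ≤ c * f t := by
    intro t ht
    rcases le_total t Υ with h1 | h1
    · rw [hT1 t ht.le h1, hc, div_mul_eq_mul_div, le_div_iff₀ hfΥ]
      exact hratio t ht h1
    · exact (hT2 t h1).le
  -- on `[0, ∞)` the truncation agrees with a continuous function
  have hint : ∀ s : ℝ, 0 ≤ s → IntervalIntegrable hT volume 0 s := by
    intro s hs
    have hcont : Continuous fun t => if t ≤ Υ then h t else c * f t := by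
      refine hh.if_le (continuous_const.mul hf) continuous_id continuous_const ?_
      rintro t rfl
      simp only [hc] at hfΥ ⊢
      field_simp
    refine (hcont.intervalIntegrable 0 s).congr ?_
    intro t ht
    rw [Set.uIoc_of_le hs] at ht
    change (if t ≤ Υ then h t else c * f t) = hT t
    split_ifs with h1
    · exact (hT1 t ht.1.le h1).symm
    · exact (hT2 t (not_le.mp h1).le).symm
  have hT_nonneg : ∀ s : ℝ, 0 < s → 0 ≤ s * hT s - 2 * ∫ t in (0:ℝ)..s, hT t := by
    intro s hs
    rcases le_total s Υ with h1 | h1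
    · obtain ⟨σ₀, hσ₀, hσ⟩ := hh3 s hs
      have heq : ∫ t in (0:ℝ)..s, hT t = ∫ t in (0:ℝ)..s, h t := by
        refine intervalIntegral.integral_congr fun t ht => ?_
        rw [Set.uIcc_of_le hs.le] at ht
        exact hT1 t ht.1 (ht.2.trans h1)
      rw [heq, hT1 s hs.le h1]
      exact (by positivity : (0:ℝ) ≤ σ₀ * s ^ 2).trans (hσ s (le_abs_self s))
    · obtain ⟨σ, hσ0, hσ⟩ := hf8 s hs
      have hmono : ∫ t in (0:ℝ)..s, hT t ≤ c * ∫ t in (0:ℝ)..s, f t := by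
        rw [← intervalIntegral.integral_const_mul]
        exact intervalIntegral.integral_mono_on_of_le_Ioo hs.le (hint s hs.le)
          ((continuous_const.mul hf).intervalIntegrable 0 s) fun t ht => hle t ht.1
      have hf0 : 0 ≤ s * f s - 2 * ∫ t in (0:ℝ)..s, f t :=
        (by positivity : (0:ℝ) ≤ σ * s ^ 2).trans (hσ s (le_abs_self s))
      rw [hT2 s h1]
      linarith [mul_nonneg hc0.le hf0]
  intro s₀ hs₀
  obtain ⟨σ, hσ0, hσ⟩ := hf8 s₀ hs₀
  refine ⟨σ, hσ0, fun s hs => ?_⟩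
  have hs0 : 0 < s := hs₀.trans_le hs
  rw [intervalIntegral.integral_add (hf.intervalIntegrable 0 s) ((hint s hs0.le).const_mul β),
    intervalIntegral.integral_const_mul]
  linarith [hσ s (hs.trans (le_abs_self s)), mul_nonneg hβ0 (hT_nonneg s hs0)]
end
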